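/- For every dimension N ≥ 1 and every s ∈ (0,1), the sharp fractional Hardy constant of the half-space for p = 1 equals 𝔥_{s,1}(ℍ^N_+) = (4/s)·C_{N,s}. -/

import Mathlib

open MeasureTheory Metric Set Filter
open scoped ENNReal NNReal

/-- The `p`-th power of the Gagliardo `(s,p)`-seminorm of `u` on `A ⊆ ℝ^N`,
valued in `[0,∞]`. -/
noncomputable def gagliardo (N : ℕ) (s p : ℝ) (A : Set (EuclideanSpace ℝ (Fin N)))
    (u : EuclideanSpace ℝ (Fin N) → ℝ) : ℝ≥0∞ :=
  ∫⁻ x in A, ∫⁻ y in A, ENNReal.ofReal (|u x - u y| ^ p / dist x y ^ ((N : ℝ) + s * p))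

/-- The sharp fractional Hardy constant `𝔥_{s,p}(Ω)`, an element of `[0,∞]`. -/
noncomputable def hardyConst (N : ℕ) (s p : ℝ) (Ω : Set (EuclideanSpace ℝ (Fin N))) : ℝ≥0∞ :=
  sInf { c : ℝ≥0∞ | ∃ u : EuclideanSpace ℝ (Fin N) → ℝ,
    ContDiff ℝ (⊤ : ℕ∞) u ∧ HasCompactSupport u ∧ tsupport u ⊆ Ω ∧
    (∫ x in Ω, |u x| ^ p / Metric.infDist x (frontier Ω) ^ (s * p)) = 1 ∧
    c = gagliardo N s p Set.univ u }

/-- The half-space `ℍ^N₊ = (0,∞) × ℝ^{N-1}`. -/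
noncomputable def halfSpace (N : ℕ) (hN : 0 < N) : Set (EuclideanSpace ℝ (Fin N)) :=
  {x | 0 < x ⟨0, hN⟩}

/-- The constant `C_{N,q}`. -/
noncomputable def Cconst (N : ℕ) (q : ℝ) : ℝ :=
  if N = 1 then 1 else
    ((N : ℝ) - 1) * (volume (Metric.ball (0 : EuclideanSpace ℝ (Fin (N - 1))) 1)).toReal *
      ∫ t in Set.Ioi (0 : ℝ), t ^ ((N : ℝ) - 2) / (1 + t ^ 2) ^ (((N : ℝ) + q) / 2)

abbrev EE (n : ℕ) := EuclideanSpace ℝ (Fin n)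

noncomputable def tl {n : ℕ} (x : EE (n+1)) : EE n := WithLp.toLp 2 (fun i => x i.succ)

lemma mp_split (n : ℕ) : MeasurePreserving (fun x : EE (n+1) => (x 0, tl x))
    volume ((volume : Measure ℝ).prod (volume : Measure (EE n))) := by
  have h1 := PiLp.volume_preserving_ofLp (Fin (n+1))
  have h2 := volume_preserving_piFinSuccAbove (fun _ : Fin (n + 1) => ℝ) 0
  have h3 := (MeasurePreserving.id (volume : Measure ℝ)).prod (PiLp.volume_preserving_toLp (Fin n))
  have := h3.comp (h2.comp h1)
  exact this

lemma lint_split {n : ℕ} {F : ℝ × EE n → ℝ≥0∞} (hF : Measurable F) :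
    ∫⁻ x : EE (n+1), F (x 0, tl x) = ∫⁻ t, ∫⁻ z, F (t, z) := by
  rw [(mp_split n).lintegral_comp hF, lintegral_prod _ hF.aemeasurable]

lemma norm_split {n : ℕ} (x : EE (n+1)) : ‖x‖ ^ 2 = (x 0)^2 + ‖tl x‖ ^ 2 := by
  rw [EuclideanSpace.real_norm_sq_eq, EuclideanSpace.real_norm_sq_eq, Fin.sum_univ_succ]; rfl

lemma tl_add {n : ℕ} (x y : EE (n+1)) : tl (x + y) = tl x + tl y := rfl

lemma norm_tl_le {n : ℕ} (x : EE (n+1)) : ‖tl x‖ ≤ ‖x‖ := by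
  apply le_of_sq_le_sq _ (norm_nonneg _) |> fun h => h
  rw [norm_split]; nlinarith [sq_nonneg (x 0)]

lemma contDiff_tl {n : ℕ} : ContDiff ℝ (⊤ : ℕ∞) (tl : EE (n+1) → EE n) := by
  unfold tl
  rw [contDiff_euclidean]
  intro i
  simp only []
  fun_prop

lemma continuous_tl {n : ℕ} : Continuous (tl : EE (n+1) → EE n) := contDiff_tl.continuous

noncomputable def kk (n : ℕ) (s : ℝ) (h : EE (n+1)) : ℝ≥0∞ :=
  ENNReal.ofReal ((‖h‖ ^ (((n+1 : ℕ) : ℝ) + s))⁻¹)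

lemma meas_kk (n : ℕ) (s : ℝ) : Measurable (kk n s) := by
  unfold kk; fun_prop

noncomputable def DD {n : ℕ} (u : EE n → ℝ) (h : EE n) : ℝ≥0∞ := ∫⁻ x, ‖u (x + h) - u x‖ₑ

lemma gag_eq {n : ℕ} {s : ℝ} {u : EE (n+1) → ℝ} (hu : Continuous u) :
    gagliardo (n+1) s 1 univ u = ∫⁻ h, kk n s h * DD u h := by
  unfold gagliardo DD
  simp only [Measure.restrict_univ, Real.rpow_one, mul_one]
  have h1 : ∀ x : EE (n+1), ∫⁻ y, ENNReal.ofReal (|u x - u y| / dist x y ^ (((n+1 : ℕ) : ℝ) + s))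
      = ∫⁻ h, kk n s h * ‖u (x + h) - u x‖ₑ := by
    intro x
    rw [← lintegral_add_left_eq_self _ x]
    congr 1; ext h
    rw [div_eq_inv_mul, ENNReal.ofReal_mul (by positivity), dist_self_add_right, abs_sub_comm,
      ← Real.norm_eq_abs, ofReal_norm]
    rfl
  simp_rw [h1]
  rw [lintegral_lintegral_swap]
  · congr 1; ext h
    rw [lintegral_const_mul _ (by fun_prop)]
  · apply Measurable.aemeasurable
    have := meas_kk n s
    unfold Function.uncurry
    fun_prop

/-- Cₑ -/
noncomputable def Ce (n : ℕ) (s : ℝ) : ℝ≥0∞ :=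
  ∫⁻ z : EE n, ENNReal.ofReal ((1 + ‖z‖^2) ^ (-(((n+1 : ℕ) : ℝ) + s)/2))

lemma Ce_eq {n : ℕ} {s : ℝ} (hs : 0 < s) : Ce n s = ENNReal.ofReal (Cconst (n+1) s) := by
  unfold Ce
  rw [← ofReal_integral_eq_lintegral_ofReal]
  · congr 1
    unfold Cconst
    split_ifs with h
    · obtain rfl : n = 0 := by omega
      rw [volume_euclideanSpace_eq_dirac]
      simp
    · have hn : 0 < n := by omega
      have : Nonempty (Fin n) := ⟨⟨0, hn⟩⟩
      have : Nontrivial (EE n) := inferInstance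
      have := integral_fun_norm_addHaar (volume : Measure (EE n))
        (fun r : ℝ => (1 + r^2) ^ (-(((n+1 : ℕ) : ℝ) + s)/2))
      rw [this]
      simp only [finrank_euclideanSpace, Fintype.card_fin, nsmul_eq_mul, smul_eq_mul]
      rw [mul_assoc]
      congr 1
      · push_cast; ring
      congr 1
      apply setIntegral_congr_fun measurableSet_Ioi
      intro t ht
      simp only [mem_Ioi] at ht
      simp only []
      rw [neg_div, Real.rpow_neg (by positivity), div_eq_mul_inv]
      congr 1
      rw [← Real.rpow_natCast]
      congr 1
      push_cast [Nat.cast_sub hn]; ring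
  · apply integrable_rpow_neg_one_add_norm_sq
    simp; linarith
  · filter_upwards with z; positivity

lemma lint_scale {n : ℕ} {F : EE n → ℝ≥0∞} (hF : Measurable F) {r : ℝ} (hr : r ≠ 0) :
    ∫⁻ z, F (r • z) = ENNReal.ofReal (|(r ^ n)⁻¹|) * ∫⁻ z, F z := by
  rw [← lintegral_map (f := F) hF (measurable_const_smul r), Measure.map_addHaar_smul _ hr]
  simp

lemma inner_kk {n : ℕ} {s : ℝ} (hs : 0 < s) {t : ℝ} (ht : t ≠ 0) :
    ∫⁻ z : EE n, ENNReal.ofReal (((t^2 + ‖z‖^2) ^ ((((n+1 : ℕ) : ℝ) + s)/2))⁻¹)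
      = ENNReal.ofReal (|t| ^ (-1-s)) * Ce n s := by
  have h0 := lint_scale (n := n) (F := fun z => ENNReal.ofReal (((t^2 + ‖z‖^2) ^ ((((n+1 : ℕ) : ℝ) + s)/2))⁻¹)) (by fun_prop) (abs_ne_zero.2 ht)
  have ht' : 0 < |t| := abs_pos.2 ht
  have h1 : ∀ z : EE n, ENNReal.ofReal (((t^2 + ‖|t| • z‖^2) ^ ((((n+1 : ℕ) : ℝ) + s)/2))⁻¹)
      = ENNReal.ofReal (|t| ^ (-(((n+1 : ℕ) : ℝ) + s))) * ENNReal.ofReal ((1 + ‖z‖^2) ^ (-(((n+1 : ℕ) : ℝ) + s)/2)) := by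
    intro z
    rw [← ENNReal.ofReal_mul (by positivity)]
    congr 1
    rw [norm_smul, Real.norm_eq_abs, abs_abs, ← sq_abs t, mul_pow, ← mul_one_add,
      Real.mul_rpow (by positivity) (by positivity), mul_inv, neg_div, Real.rpow_neg (by positivity),
      Real.rpow_neg (by positivity), ← Real.rpow_natCast, ← Real.rpow_mul (by positivity)]
    congr 3; push_cast; ring
  simp only [h1] at h0
  rw [lintegral_const_mul _ (by fun_prop)] at h0
  change _ * Ce n s = _ at h0
  have h2 : ENNReal.ofReal (|t|^n) * ENNReal.ofReal |(|t| ^ n)⁻¹| = 1 := by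
    rw [← ENNReal.ofReal_mul (by positivity), abs_of_pos (a := (|t| ^ n)⁻¹) (by positivity), mul_inv_cancel₀ (by positivity)]
    simp
  calc _ = ENNReal.ofReal (|t|^n) * (ENNReal.ofReal |(|t| ^ n)⁻¹| * ∫⁻ z : EE n, ENNReal.ofReal (((t^2 + ‖z‖^2) ^ ((((n+1 : ℕ) : ℝ) + s)/2))⁻¹)) := by
        rw [← mul_assoc, h2, one_mul]
    _ = _ := by
        rw [← h0, ← mul_assoc, ← ENNReal.ofReal_mul (by positivity), ← Real.rpow_natCast,
          ← Real.rpow_add ht']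
        congr 3; push_cast; ring

lemma kk_slice {n : ℕ} {s : ℝ} (hs : 0 < s) {φ : ℝ → ℝ≥0∞} (hφ : Measurable φ) :
    ∫⁻ h : EE (n+1), kk n s h * φ (h 0) =
      Ce n s * ∫⁻ t, ENNReal.ofReal (|t| ^ (-1-s)) * φ t := by
  have h1 : ∀ h : EE (n+1), kk n s h = ENNReal.ofReal ((((h 0)^2 + ‖tl h‖^2) ^ ((((n+1 : ℕ) : ℝ) + s)/2))⁻¹) := by
    intro h
    rw [← norm_split, kk, ← Real.rpow_natCast, ← Real.rpow_mul (norm_nonneg _)]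
    congr 3; push_cast; ring
  simp_rw [h1]
  rw [lint_split (F := fun q : ℝ × EE n => ENNReal.ofReal (((q.1^2 + ‖q.2‖^2) ^ ((((n+1 : ℕ) : ℝ) + s)/2))⁻¹) * φ q.1) (by fun_prop)]
  rw [← lintegral_const_mul _ (by fun_prop)]
  apply lintegral_congr_ae
  filter_upwards [compl_mem_ae_iff.2 (measure_singleton (0:ℝ))] with t ht
  rw [lintegral_mul_const _ (by fun_prop), inner_kk hs ht]
  ring

lemma tail_int {s : ℝ} (hs : 0 < s) {a : ℝ} (ha : 0 < a) :
    ∫⁻ t, ENNReal.ofReal (|t| ^ (-1-s)) * (if a < |t| then 1 else 0) = ENNReal.ofReal (2 / s * a ^ (-s)) := by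
  have h1 : ∀ t : ℝ, ENNReal.ofReal (|t| ^ (-1-s)) * (if a < |t| then 1 else 0) =
      (Iio (-a)).indicator (fun t => ENNReal.ofReal (|t| ^ (-1-s))) t + (Ioi a).indicator (fun t => ENNReal.ofReal (|t| ^ (-1-s))) t := by
    intro t
    simp only [indicator, mem_Iio, mem_Ioi, lt_abs]
    by_cases h : a < t
    · have : ¬ t < -a := by linarith
      simp [h, this]
    · by_cases h' : t < -a
      · have : a < -t := by linarith
        simp [h, h', this]
      · have : ¬ a < -t := by linarith
        simp [h, h', this]
  simp_rw [h1]
  rw [lintegral_add_left (by apply Measurable.indicator (by fun_prop) measurableSet_Iio), lintegral_indicator measurableSet_Iio, lintegral_indicator measurableSet_Ioi]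
  have h2 : ∫⁻ t in Ioi a, ENNReal.ofReal (|t| ^ (-1-s)) = ENNReal.ofReal (1 / s * a ^ (-s)) := by
    rw [setLIntegral_congr_fun (g := fun t => ENNReal.ofReal (t ^ (-1-s))) measurableSet_Ioi]
    · rw [← ofReal_integral_eq_lintegral_ofReal]
      · rw [integral_Ioi_rpow_of_lt (by linarith) ha]
        congr 1
        have : -1 - s + 1 = -s := by ring
        rw [this]; field_simp
      · exact integrableOn_Ioi_rpow_of_lt (by linarith) ha
      · filter_upwards [ae_restrict_mem measurableSet_Ioi] with t ht
        exact Real.rpow_nonneg (ha.trans ht).le _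
    · intro t ht
      simp only []
      rw [abs_of_pos (ha.trans ht)]
  have h3 : ∫⁻ t in Iio (-a), ENNReal.ofReal (|t| ^ (-1-s)) = ∫⁻ t in Ioi a, ENNReal.ofReal (|t| ^ (-1-s)) := by
    rw [← lintegral_indicator measurableSet_Iio, ← lintegral_indicator measurableSet_Ioi, ← lintegral_neg_eq_self]
    congr 1; ext t
    simp [indicator]
  rw [h3, h2, ← ENNReal.ofReal_add (by positivity) (by positivity)]
  congr 1; ring

lemma DD_neg {n : ℕ} (u : EE n → ℝ) (h : EE n) : DD u (-h) = DD u h := by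
  unfold DD
  rw [← lintegral_add_right_eq_self _ h]
  congr 1; ext x
  rw [add_neg_cancel_right, ← enorm_neg, neg_sub]

lemma meas_coord {n : ℕ} (i : Fin n) : Measurable (fun x : EE n => x i) := by fun_prop

lemma DD_lower_aux {n : ℕ} {u : EE (n+1) → ℝ} (hu : Continuous u) (hc : HasCompactSupport u)
    (h0 : ∀ x : EE (n+1), x 0 ≤ 0 → u x = 0) (h : EE (n+1)) :
    2 * ∫⁻ x, {x : EE (n+1) | x 0 ≤ h 0}.indicator (fun x => ‖u x‖ₑ) x ≤ DD u h := by
  have hUfin : ∫⁻ x, ‖u x‖ₑ < ∞ := (hu.integrable_of_hasCompactSupport hc).2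
  set W := ∫⁻ x, {x : EE (n+1) | x 0 ≤ h 0}.indicator (fun x => ‖u x‖ₑ) x with hW
  set V := ∫⁻ x, {x : EE (n+1) | x 0 ≤ h 0}ᶜ.indicator (fun x => ‖u x‖ₑ) x with hV
  have hm : MeasurableSet {x : EE (n+1) | x 0 ≤ h 0} := measurableSet_le (meas_coord 0) measurable_const
  have hm0 : MeasurableSet {x : EE (n+1) | x 0 ≤ 0} := measurableSet_le (meas_coord 0) measurable_const
  have hUVW : ∫⁻ x, ‖u x‖ₑ = W + V := by
    rw [hW, hV, lintegral_indicator hm, lintegral_indicator hm.compl, lintegral_add_compl _ hm]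
  have hV' : V = ∫⁻ x, {x : EE (n+1) | x 0 ≤ 0}ᶜ.indicator (fun x => ‖u (x+h)‖ₑ) x := by
    rw [hV, ← lintegral_add_right_eq_self _ h]
    congr 1; ext x; simp [indicator]
  have hW' : W = ∫⁻ x, {x : EE (n+1) | x 0 ≤ 0}.indicator (fun x => ‖u (x+h)‖ₑ) x := by
    rw [hW, ← lintegral_add_right_eq_self _ h]
    congr 1; ext x; simp [indicator]
  have hVfin : V ≠ ∞ := by
    intro hh; rw [hUVW, hh] at hUfin; simp at hUfin
  have key : (W + V) + W ≤ DD u h + V := by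
    rw [← hUVW]
    nth_rewrite 1 [hW']
    rw [hV', DD, ← lintegral_add_left (by fun_prop), ← lintegral_add_left (by fun_prop)]
    apply lintegral_mono
    intro x
    simp only [indicator, mem_compl_iff, mem_ofPred_eq]
    by_cases hx : x 0 ≤ 0
    · simp [hx, h0 x hx]
    · simp only [hx, if_false, not_false_eq_true, if_true, add_zero]
      calc ‖u x‖ₑ = ‖u (x+h) - (u (x+h) - u x)‖ₑ := by congr 1; ring
        _ ≤ ‖u (x+h)‖ₑ + ‖u (x+h) - u x‖ₑ := enorm_sub_le
        _ = _ := add_comm _ _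
  have : 2 * W + V ≤ DD u h + V := by
    convert key using 1; ring
  exact (ENNReal.add_le_add_iff_right hVfin).1 this

lemma DD_lower {n : ℕ} {u : EE (n+1) → ℝ} (hu : Continuous u) (hc : HasCompactSupport u)
    (h0 : ∀ x : EE (n+1), x 0 ≤ 0 → u x = 0) (h : EE (n+1)) :
    2 * ∫⁻ x, ‖u x‖ₑ * (if x 0 < |h 0| then 1 else 0) ≤ DD u h := by
  have : ∀ h : EE (n+1), 0 ≤ h 0 → 2 * ∫⁻ x, ‖u x‖ₑ * (if x 0 < |h 0| then 1 else 0) ≤ DD u h := by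
    intro h hh
    refine le_trans ?_ (DD_lower_aux hu hc h0 h)
    gcongr with x
    rw [abs_of_nonneg hh]
    simp only [indicator, mem_ofPred_eq]
    split_ifs with h1 h2 h2
    · simp
    · exact absurd h1.le h2
    · simp
    · simp
  rcases le_total 0 (h 0) with hh | hh
  · exact this h hh
  · have := this (-h) (by simpa using hh)
    rw [DD_neg] at this
    simpa using this

noncomputable def JJ {n : ℕ} (s : ℝ) (u : EE (n+1) → ℝ) : ℝ≥0∞ :=
  ∫⁻ x in {x : EE (n+1) | 0 < x 0}, ‖u x‖ₑ * ENNReal.ofReal ((x 0) ^ (-s))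

lemma gag_lower {n : ℕ} {s : ℝ} (hs : 0 < s) {u : EE (n+1) → ℝ} (hu : Continuous u) (hc : HasCompactSupport u)
    (h0 : ∀ x : EE (n+1), x 0 ≤ 0 → u x = 0) :
    Ce n s * ENNReal.ofReal (4 / s) * JJ s u ≤ gagliardo (n+1) s 1 univ u := by
  rw [gag_eq hu]
  have hkm := meas_kk n s
  have hms : MeasurableSet {x : EE (n+1) | 0 < x 0} := measurableSet_lt measurable_const (meas_coord 0)
  have hmi : Measurable (fun q : EE (n+1) × EE (n+1) => (if q.2 0 < |q.1 0| then 1 else 0 : ℝ≥0∞)) := by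
    apply Measurable.ite _ measurable_const measurable_const
    apply measurableSet_lt <;> fun_prop
  have hmi1 : ∀ h : EE (n+1), Measurable (fun x : EE (n+1) => (if x 0 < |h 0| then 1 else 0 : ℝ≥0∞)) :=
    fun h => hmi.comp (measurable_const.prodMk measurable_id)
  have hmi2 : ∀ x : EE (n+1), Measurable (fun h : EE (n+1) => (if x 0 < |h 0| then 1 else 0 : ℝ≥0∞)) :=
    fun x => hmi.comp (measurable_id.prodMk measurable_const)
  calc Ce n s * ENNReal.ofReal (4 / s) * JJ s u
      = ∫⁻ x in {x : EE (n+1) | 0 < x 0}, (∫⁻ h, 2 * kk n s h * (‖u x‖ₑ * (if x 0 < |h 0| then 1 else 0))) := by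
        rw [JJ, ← lintegral_const_mul _ (by fun_prop)]
        apply setLIntegral_congr_fun hms
        intro x hx
        simp only [mem_ofPred_eq] at hx
        simp only []
        have h1 := kk_slice (n := n) hs (φ := fun t => if x 0 < |t| then 1 else 0)
          (Measurable.ite (measurableSet_lt measurable_const (by fun_prop)) measurable_const measurable_const)
        rw [tail_int hs hx] at h1
        have h2 : ∀ h : EE (n+1), 2 * kk n s h * (‖u x‖ₑ * (if x 0 < |h 0| then 1 else 0))
          = 2 * ‖u x‖ₑ * (kk n s h * (if x 0 < |h 0| then 1 else 0)) := by intro h; ring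
        simp_rw [h2]
        have hm2 := hmi2 x
        rw [lintegral_const_mul _ (by fun_prop), h1, ENNReal.ofReal_mul (by positivity)]
        have : ENNReal.ofReal (4 / s) = 2 * ENNReal.ofReal (2 / s) := by
          rw [show (2 : ℝ≥0∞) = ENNReal.ofReal 2 by simp, ← ENNReal.ofReal_mul (by norm_num)]
          congr 1; ring
        rw [this]; ring
    _ ≤ ∫⁻ x, (∫⁻ h, 2 * kk n s h * (‖u x‖ₑ * (if x 0 < |h 0| then 1 else 0))) :=
        setLIntegral_le_lintegral _ _
    _ = ∫⁻ h, ∫⁻ x, 2 * kk n s h * (‖u x‖ₑ * (if x 0 < |h 0| then 1 else 0)) := by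
        rw [lintegral_lintegral_swap]
        apply Measurable.aemeasurable
        unfold Function.uncurry
        have := hmi.comp measurable_swap
        simp only [Function.comp_def, Prod.fst_swap, Prod.snd_swap] at this
        exact ((hkm.comp measurable_snd).const_mul 2).mul ((hu.measurable.comp measurable_fst).enorm.mul this)
    _ ≤ ∫⁻ h, kk n s h * DD u h := by
        apply lintegral_mono
        intro h
        have := hmi1 h
        simp only []
        rw [lintegral_const_mul _ (by fun_prop), mul_comm 2, mul_assoc]
        gcongr
        exact DD_lower hu hc h0 h

lemma infDist_half {n : ℕ} (hN : 0 < n + 1) {x : EE (n+1)} (hx : 0 < x 0) :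
    Metric.infDist x (frontier (halfSpace (n+1) hN)) = x 0 := by
  have hpr : IsOpenMap (fun x : EE (n+1) => x 0) := by
    have := (EuclideanSpace.proj (𝕜 := ℝ) (0 : Fin (n+1)) : EE (n+1) →L[ℝ] ℝ).isOpenMap ?_
    · exact this
    · intro t; exact ⟨EuclideanSpace.single 0 t, by simp⟩
  have hfr : frontier (halfSpace (n+1) hN) = {x : EE (n+1) | x 0 = 0} := by
    have := hpr.preimage_frontier_eq_frontier_preimage (by fun_prop) (Ioi 0)
    rw [frontier_Ioi] at this
    exact this.symm
  rw [hfr]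
  apply le_antisymm
  · have hm : x - EuclideanSpace.single 0 (x 0) ∈ {x : EE (n+1) | x 0 = 0} := by simp
    refine (Metric.infDist_le_dist_of_mem hm).trans ?_
    rw [dist_self_sub_right]
    simp [abs_of_pos hx]
  · rw [Metric.le_infDist ⟨0, by simp⟩]
    intro y hy
    simp only [mem_ofPred_eq] at hy
    have := PiLp.norm_apply_le (x - y) 0
    rw [dist_eq_norm]
    simp [hy] at this
    exact (le_abs_self _).trans this

lemma hardy_int {n : ℕ} (hN : 0 < n + 1) {s : ℝ} {u : EE (n+1) → ℝ} (hu : Continuous u) :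
    (∫ x in halfSpace (n+1) hN, |u x| ^ (1:ℝ) / Metric.infDist x (frontier (halfSpace (n+1) hN)) ^ (s * 1))
      = (JJ s u).toReal := by
  have hms : MeasurableSet (halfSpace (n+1) hN) := measurableSet_lt measurable_const (meas_coord 0)
  have : (∫ x in halfSpace (n+1) hN, |u x| ^ (1:ℝ) / Metric.infDist x (frontier (halfSpace (n+1) hN)) ^ (s * 1))
    = ∫ x in halfSpace (n+1) hN, |u x| * (x 0) ^ (-s) := by
    apply setIntegral_congr_fun hms
    intro x hx
    have hx' : 0 < x 0 := hx
    simp only [infDist_half hN hx', Real.rpow_one, mul_one, Real.rpow_neg hx'.le, div_eq_mul_inv]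
  rw [this, integral_eq_lintegral_of_nonneg_ae]
  · congr 1
    apply setLIntegral_congr_fun hms
    intro x hx
    simp only []
    rw [ENNReal.ofReal_mul (abs_nonneg _), ← Real.norm_eq_abs, ofReal_norm]
  · filter_upwards [ae_restrict_mem hms] with x hx
    have hx' : 0 < x 0 := hx
    simp only [Pi.zero_apply]
    positivity
  · apply Measurable.aestronglyMeasurable
    fun_prop

lemma lower_main {n : ℕ} (hN : 0 < n + 1) {s : ℝ} (hs : s ∈ Ioo (0:ℝ) 1) :
    ENNReal.ofReal (4 / s * Cconst (n+1) s) ≤ hardyConst (n+1) s 1 (halfSpace (n+1) hN) := by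
  apply le_sInf
  rintro c ⟨u, hu, hc, hts, hint, rfl⟩
  rw [hardy_int hN hu.continuous] at hint
  have hJ : JJ s u = 1 := by
    rwa [ENNReal.toReal_eq_one_iff] at hint
  have := gag_lower hs.1 hu.continuous hc (fun x hx => by
    by_contra hne
    have h1 : 0 < x 0 := hts (subset_tsupport _ hne)
    linarith)
  rw [hJ, mul_one, Ce_eq hs.1, mul_comm] at this
  have h4 : 0 < 4 / s := by have := hs.1; positivity
  rw [ENNReal.ofReal_mul h4.le]
  exact this

lemma gag_smul {n : ℕ} {s : ℝ} {u : EE (n+1) → ℝ} (hu : Continuous u) (c : ℝ) :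
    gagliardo (n+1) s 1 univ (fun x => c * u x) = ‖c‖ₑ * gagliardo (n+1) s 1 univ u := by
  rw [gag_eq hu, gag_eq (by fun_prop)]
  have : ∀ h, DD (fun x => c * u x) h = ‖c‖ₑ * DD u h := by
    intro h
    unfold DD
    rw [← lintegral_const_mul _ (by fun_prop)]
    congr 1; ext x
    rw [← mul_sub, enorm_mul]
  have hm : Measurable (fun h => kk n s h * DD u h) := by
    have := meas_kk n s
    apply this.mul
    unfold DD
    apply Measurable.lintegral_prod_right' (f := fun q : EE (n+1) × EE (n+1) => ‖u (q.2 + q.1) - u q.2‖ₑ)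
    fun_prop
  rw [← lintegral_const_mul _ hm]
  congr 1; ext h
  rw [this]; ring

lemma hardy_le {n : ℕ} (hN : 0 < n + 1) {s : ℝ} {u : EE (n+1) → ℝ}
    (hu : ContDiff ℝ (⊤ : ℕ∞) u) (hc : HasCompactSupport u) (hts : tsupport u ⊆ halfSpace (n+1) hN)
    (hJ : JJ s u ≠ ∞) :
    hardyConst (n+1) s 1 (halfSpace (n+1) hN) * JJ s u ≤ gagliardo (n+1) s 1 univ u := by
  by_cases h0 : JJ s u = 0
  · simp [h0]
  have hpos : 0 < (JJ s u).toReal := ENNReal.toReal_pos h0 hJ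
  set c := ((JJ s u).toReal)⁻¹ with hcdef
  have hcp : 0 < c := inv_pos.2 hpos
  have hce : ‖c‖ₑ = (JJ s u)⁻¹ := by
    rw [← ofReal_norm, Real.norm_eq_abs, abs_of_pos hcp, hcdef, ENNReal.ofReal_inv_of_pos hpos,
      ENNReal.ofReal_toReal hJ]
  have hle : hardyConst (n+1) s 1 (halfSpace (n+1) hN) ≤ gagliardo (n+1) s 1 univ (fun x => c * u x) := by
    apply sInf_le
    refine ⟨fun x => c * u x, contDiff_const.mul hu, hc.mul_left, (tsupport_mul_subset_right).trans hts, ?_, rfl⟩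
    rw [hardy_int hN (by have := hu.continuous; fun_prop)]
    have : JJ s (fun x => c * u x) = ‖c‖ₑ * JJ s u := by
      unfold JJ
      have := hu.continuous
      rw [← lintegral_const_mul _ (by fun_prop)]
      congr 1; ext x
      rw [enorm_mul]; ring
    rw [this, hce, ENNReal.inv_mul_cancel h0 hJ]; simp
  rw [gag_smul hu.continuous, hce] at hle
  calc _ ≤ (JJ s u)⁻¹ * gagliardo (n+1) s 1 univ u * JJ s u := by gcongr
    _ = gagliardo (n+1) s 1 univ u * ((JJ s u)⁻¹ * JJ s u) := by ring
    _ = _ := by rw [ENNReal.inv_mul_cancel h0 hJ, mul_one]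

lemma mono_shift {p : ℝ → ℝ} (hp : Monotone p) (hc : Continuous p) {a b : ℝ} (hab : a ≤ b)
    (h0 : ∀ x ≤ a, p x = 0) (h1 : ∀ x, b ≤ x → p x = 1) {t : ℝ} (ht : 0 ≤ t) :
    ∫⁻ x, ENNReal.ofReal (p (x + t) - p x) = ENNReal.ofReal t := by
  have hz : ∀ x, x ∉ Ioc (a - t) b → p (x+t) - p x = 0 := by
    intro x hx
    rw [mem_Ioc, not_and_or, not_lt, not_le] at hx
    rcases hx with hx | hx
    · rw [h0 _ (by linarith), h0 _ (by linarith)]; simp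
    · rw [h1 _ (by linarith), h1 _ hx.le]; simp
  have hcs : HasCompactSupport (fun x => p (x+t) - p x) := by
    apply HasCompactSupport.of_support_subset_isCompact (isCompact_Icc (a := a - t) (b := b))
    intro x hx
    by_contra hn
    exact hx (hz x (fun h => hn (Ioc_subset_Icc_self h)))
  rw [← ofReal_integral_eq_lintegral_ofReal]
  · congr 1
    rw [← intervalIntegral.integral_eq_integral_of_support_subset (a := a - t) (b := b)]
    · have hi : ∀ c d, IntervalIntegrable p volume c d := fun c d => hc.intervalIntegrable c d
      rw [intervalIntegral.integral_sub ((by fun_prop : Continuous fun x => p (x+t)).intervalIntegrable _ _) (hi _ _), intervalIntegral.integral_comp_add_right,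
        intervalIntegral.integral_interval_sub_interval_comm' (hi _ _) (hi _ _) (hi _ _)]
      have e1 : ∫ x in b..b+t, p x = t := by
        rw [intervalIntegral.integral_congr (g := fun _ => 1)]
        · simp
        · intro x hx
          rw [uIcc_of_le (by linarith)] at hx
          exact h1 x hx.1
      have e2 : ∫ x in a-t..a-t+t, p x = 0 := by
        rw [intervalIntegral.integral_congr (g := fun _ => 0)]
        · simp
        · intro x hx
          rw [uIcc_of_le (by linarith)] at hx
          exact h0 x (by linarith [hx.2])
      linarith
    · intro x hx
      by_contra hn
      exact hx (hz x hn)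
  · exact Continuous.integrable_of_hasCompactSupport (by fun_prop) hcs
  · filter_upwards with x
    simpa using hp (by linarith : x ≤ x + t)

lemma exists_f {ε : ℝ} (hε : 0 < ε) (hε2 : ε < 1/2) : ∃ f : ℝ → ℝ,
    ContDiff ℝ (⊤ : ℕ∞) f ∧ (∀ x, x ∉ Icc ε (1 + ε) → f x = 0) ∧ (∀ x, 0 ≤ f x) ∧
    (∀ x ∈ Icc (2*ε) 1, f x = 1) ∧ ∫⁻ x, ‖f x‖ₑ ≤ 1 ∧
    ∀ t, ∫⁻ x, ‖f (x + t) - f x‖ₑ ≤ 2 * ENNReal.ofReal (min 1 |t|) := by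
  set p : ℝ → ℝ := fun x => Real.smoothTransition ((x - ε) / ε) with hp
  have hpm : Monotone p := by
    intro x y hxy
    apply Real.smoothTransition.monotone
    gcongr
  have hps : ContDiff ℝ (⊤ : ℕ∞) p := by
    apply Real.smoothTransition.contDiff.comp
    fun_prop
  have hpc := hps.continuous
  have hp0 : ∀ x ≤ ε, p x = 0 := fun x hx => Real.smoothTransition.zero_of_nonpos
    (div_nonpos_of_nonpos_of_nonneg (by linarith) hε.le)
  have hp1 : ∀ x, 2 * ε ≤ x → p x = 1 := fun x hx => Real.smoothTransition.one_of_one_le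
    (by rw [le_div_iff₀ hε]; linarith)
  have hf0 : ∀ x, 0 ≤ p x - p (x - (1 - ε)) := fun x => sub_nonneg.2 (hpm (by linarith))
  have hF : ∫⁻ x, ‖p x - p (x - (1 - ε))‖ₑ ≤ 1 := by
    rw [← lintegral_add_right_eq_self _ (1-ε)]
    have : ∀ x, ‖p (x + (1 - ε)) - p (x + (1-ε) - (1 - ε))‖ₑ = ENNReal.ofReal (p (x + (1 - ε)) - p x) := by
      intro x
      rw [add_sub_cancel_right, ← ofReal_norm, Real.norm_of_nonneg (sub_nonneg.2 (hpm (by linarith)))]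
    simp_rw [this]
    rw [mono_shift hpm hpc (by linarith) hp0 hp1 (by linarith)]
    exact ENNReal.ofReal_le_one.2 (by linarith)
  have hA : ∀ t, 0 ≤ t → ∫⁻ x, ‖(p (x + t) - p (x + t - (1 - ε))) - (p x - p (x - (1 - ε)))‖ₑ ≤ 2 * ENNReal.ofReal t := by
    intro t ht
    have : ∀ x, ‖(p (x + t) - p (x + t - (1 - ε))) - (p x - p (x - (1 - ε)))‖ₑ
        ≤ ENNReal.ofReal (p (x + t) - p x) + ENNReal.ofReal (p ((x - (1-ε)) + t) - p (x - (1 - ε))) := by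
      intro x
      have m1 := hpm (by linarith : x ≤ x + t)
      have m2 := hpm (by linarith : x - (1-ε) ≤ x - (1-ε) + t)
      rw [← ENNReal.ofReal_add (by linarith) (by linarith), ← ofReal_norm, Real.norm_eq_abs]
      apply ENNReal.ofReal_le_ofReal
      have : x + t - (1 - ε) = x - (1-ε) + t := by ring
      rw [this, abs_le]; constructor <;> linarith
    refine (lintegral_mono this).trans ?_
    rw [lintegral_add_left (by fun_prop),
      lintegral_sub_right_eq_self (fun x => ENNReal.ofReal (p (x + t) - p x)),
      mono_shift hpm hpc (by linarith) hp0 hp1 ht, two_mul]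
  refine ⟨fun x => p x - p (x - (1 - ε)), ?_, ?_, hf0, ?_, hF, ?_⟩
  · apply hps.sub
    apply hps.comp
    fun_prop
  · intro x hx
    rw [mem_Icc, not_and_or, not_le, not_le] at hx
    simp only []
    rcases hx with hx | hx
    · rw [hp0 _ hx.le, hp0 _ (by linarith)]; simp
    · rw [hp1 _ (by linarith), hp1 _ (by linarith)]; simp
  · intro x hx
    simp only []
    rw [hp1 _ hx.1, hp0 _ (by linarith [hx.2])]; simp
  · intro t
    simp only []
    have hA' : ∫⁻ x, ‖(p (x + t) - p (x + t - (1 - ε))) - (p x - p (x - (1 - ε)))‖ₑ ≤ 2 * ENNReal.ofReal |t| := by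
      rcases le_total 0 t with ht | ht
      · rw [abs_of_nonneg ht]; exact hA t ht
      · rw [abs_of_nonpos ht]
        refine le_trans (le_of_eq ?_) (hA (-t) (by linarith))
        conv_rhs => rw [← lintegral_add_right_eq_self _ t]
        congr 1; ext x
        rw [← enorm_neg, neg_sub, add_neg_cancel_right]
    rcases le_total 1 |t| with h | h
    · rw [min_eq_left h]
      have hfc : Continuous (fun x => p x - p (x - (1 - ε))) := by fun_prop
      calc _ ≤ ∫⁻ x, (‖p (x + t) - p (x + t - (1 - ε))‖ₑ + ‖p x - p (x - (1 - ε))‖ₑ) :=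
            lintegral_mono (fun x => enorm_sub_le)
        _ ≤ 1 + 1 := by
            rw [lintegral_add_left (by fun_prop),
              lintegral_add_right_eq_self (fun x => ‖p x - p (x - (1 - ε))‖ₑ)]
            gcongr
        _ = _ := by norm_num
    · rw [min_eq_right h]; exact hA'

lemma exists_g (n : ℕ) : ∃ g : EE n → ℝ, ContDiff ℝ (⊤ : ℕ∞) g ∧ HasCompactSupport g ∧
    ∫⁻ z, ‖g z‖ₑ ≠ 0 ∧ ∫⁻ z, ‖g z‖ₑ ≠ ∞ ∧ ∃ K : ℝ≥0∞, K ≠ ∞ ∧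
    ∀ h, ∫⁻ z, ‖g (z + h) - g z‖ₑ ≤ K * ENNReal.ofReal (min 1 ‖h‖) := by
  let g : ContDiffBump (0 : EE n) := ⟨1, 2, by norm_num, by norm_num⟩
  have hgs : ContDiff ℝ (⊤ : ℕ∞) g := g.contDiff
  have hgc : HasCompactSupport g := g.hasCompactSupport
  have hcont : Continuous g := hgs.continuous
  have hfin : ∫⁻ z, ‖g z‖ₑ ≠ ∞ := (hcont.integrable_of_hasCompactSupport hgc).2.ne
  obtain ⟨L, hL⟩ := hgs.lipschitzWith_of_hasCompactSupport hgc (by simp)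
  refine ⟨g, hgs, hgc, ?_, hfin, 2 * (∫⁻ z, ‖g z‖ₑ) + L * volume (ball (0 : EE n) 3), ?_, ?_⟩
  · intro h
    rw [lintegral_eq_zero_iff (by fun_prop)] at h
    have h2 : (fun z => ‖g z‖ₑ) = 0 := (Continuous.ae_eq_iff_eq volume (by fun_prop) (by fun_prop)).1 h
    have := congrFun h2 0
    simp only [Pi.zero_apply, enorm_eq_zero] at this
    rw [g.one_of_mem_closedBall (by simp [g])] at this
    norm_num at this
  · exact ENNReal.add_ne_top.2 ⟨ENNReal.mul_ne_top (by simp) hfin, ENNReal.mul_ne_top (by simp) measure_ball_lt_top.ne⟩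
  · intro h
    rcases le_total 1 ‖h‖ with hh | hh
    · rw [min_eq_left hh]
      calc _ ≤ ∫⁻ z, (‖g (z + h)‖ₑ + ‖g z‖ₑ) := lintegral_mono (fun x => enorm_sub_le)
        _ = 2 * ∫⁻ z, ‖g z‖ₑ := by
          have hm : Measurable (fun z => ‖g (z + h)‖ₑ) := (hcont.comp (continuous_add_const h)).measurable.enorm
          rw [lintegral_add_left hm, lintegral_add_right_eq_self (fun z => ‖g z‖ₑ), two_mul]
        _ ≤ _ := by simp
    · rw [min_eq_right hh]
      calc _ ≤ ∫⁻ z, (ball (0 : EE n) 3).indicator (fun _ => L * ENNReal.ofReal ‖h‖) z := by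
            apply lintegral_mono
            intro z
            simp only [indicator]
            split_ifs with hz
            · have := hL.edist_le_mul (z + h) z
              rw [edist_eq_enorm_sub, edist_eq_enorm_sub] at this
              simpa using this
            · have hz' : 3 ≤ ‖z‖ := by simpa using hz
              have h1 : g z = 0 := g.zero_of_le_dist (by simp [g]; linarith)
              have h2 : g (z + h) = 0 := g.zero_of_le_dist (by
                have : ‖z‖ ≤ ‖z + h‖ + ‖h‖ := by
                  have := norm_sub_le (z+h) h
                  simpa using this
                simp [g]; linarith)
              simp [h1, h2]
        _ = L * volume (ball (0 : EE n) 3) * ENNReal.ofReal ‖h‖ := by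
            rw [lintegral_indicator measurableSet_ball, setLIntegral_const]; ring
        _ ≤ _ := by gcongr; simp

lemma fin_kk {n : ℕ} {s : ℝ} (hs : s ∈ Ioo (0:ℝ) 1) :
    ∫⁻ h : EE (n+1), kk n s h * ENNReal.ofReal (min 1 ‖h‖) ≠ ∞ := by
  have hi : Integrable (fun h : EE (n+1) => (‖h‖ ^ (((n+1 : ℕ) : ℝ) + s))⁻¹ * min 1 ‖h‖) := by
    rw [integrable_fun_norm_addHaar volume (f := fun r => (r ^ (((n+1 : ℕ) : ℝ) + s))⁻¹ * min 1 r)]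
    simp only [finrank_euclideanSpace, Fintype.card_fin, smul_eq_mul, Nat.add_sub_cancel]
    rw [← Ioc_union_Ioi_eq_Ioi (zero_le_one' ℝ)]
    apply IntegrableOn.union
    · have := (intervalIntegral.intervalIntegrable_rpow' (a := 0) (b := 1) (r := -s) (by linarith [hs.2]))
      rw [intervalIntegrable_iff_integrableOn_Ioc_of_le zero_le_one] at this
      refine this.congr_fun ?_ measurableSet_Ioc
      intro r hr
      simp only []
      rw [min_eq_right hr.2, ← Real.rpow_neg hr.1.le, ← Real.rpow_natCast, ← mul_assoc, ← Real.rpow_add hr.1]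
      nth_rewrite 3 [← Real.rpow_one r]
      rw [← Real.rpow_add hr.1]
      congr 1; push_cast; ring
    · have := integrableOn_Ioi_rpow_of_lt (a := -1-s) (by linarith [hs.1]) one_pos
      refine this.congr_fun ?_ measurableSet_Ioi
      intro r hr
      have hr1 : 1 < r := hr
      have hr0 : 0 < r := by linarith
      simp only []
      rw [min_eq_left hr1.le, ← Real.rpow_neg hr0.le, ← Real.rpow_natCast, mul_one, ← Real.rpow_add hr0]
      congr 1; push_cast; ring
  have := hi.lintegral_lt_top.ne
  convert this using 3 with h
  rw [ENNReal.ofReal_mul (by positivity)]; rfl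

lemma tend_kk {n : ℕ} {s : ℝ} (hs : s ∈ Ioo (0:ℝ) 1) :
    Tendsto (fun m : ℕ => ∫⁻ h : EE (n+1), kk n s h * ENNReal.ofReal (min 1 (‖h‖ / ((m : ℝ) + 1)))) atTop (nhds 0) := by
  have hkm := meas_kk n s
  have := tendsto_lintegral_of_dominated_convergence (μ := (volume : Measure (EE (n+1))))
    (F := fun (m : ℕ) h => kk n s h * ENNReal.ofReal (min 1 (‖h‖ / ((m : ℝ) + 1)))) (f := fun _ => 0)
    (fun h => kk n s h * ENNReal.ofReal (min 1 ‖h‖)) (fun m => by fun_prop) ?_ (fin_kk hs) ?_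
  · simpa using this
  · intro m
    filter_upwards with h
    gcongr
    apply div_le_self (norm_nonneg _)
    have : (0:ℝ) ≤ m := by positivity
    linarith
  · filter_upwards with h
    have h1 : Tendsto (fun m : ℕ => ‖h‖ / ((m : ℝ) + 1)) atTop (nhds 0) := by
      simpa [Function.comp_def] using tendsto_const_div_atTop_nhds_zero_nat ‖h‖ |>.comp (tendsto_add_atTop_nat 1)
    have h2 : Tendsto (fun m : ℕ => ENNReal.ofReal (min 1 (‖h‖ / ((m : ℝ) + 1)))) atTop (nhds 0) := by
      have := ENNReal.tendsto_ofReal ((tendsto_const_nhds (x := (1:ℝ))).min h1)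
      simpa using this
    have h3 := ENNReal.Tendsto.const_mul (a := kk n s h) h2 (Or.inr (by simp [kk]))
    simpa using h3

lemma min_int {s : ℝ} (hs : 0 < s) :
    ∫⁻ t, ENNReal.ofReal (|t| ^ (-1-s)) * ENNReal.ofReal (min 1 |t|) ≤
      ENNReal.ofReal (2 / s) * ∫⁻ x in Ioc (0:ℝ) 1, ENNReal.ofReal (x ^ (-s)) := by
  have h1 : ∀ t : ℝ, ENNReal.ofReal (min 1 |t|) ≤ ∫⁻ x in Ioc (0:ℝ) 1, (if x < |t| then 1 else 0) := by
    intro t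
    have : ∀ x : ℝ, (if x < |t| then 1 else 0 : ℝ≥0∞) = (Iio |t|).indicator 1 x := by
      intro x; simp [indicator]
    simp_rw [this]
    rw [lintegral_indicator_one measurableSet_Iio, Measure.restrict_apply measurableSet_Iio]
    have : ENNReal.ofReal (min 1 |t|) = volume (Ioo 0 (min 1 |t|)) := by simp
    rw [this]
    apply measure_mono
    intro x hx
    exact ⟨lt_of_lt_of_le hx.2 (min_le_right _ _), hx.1, (lt_of_lt_of_le hx.2 (min_le_left _ _)).le⟩
  have hmi : Measurable (fun q : ℝ × ℝ => (if q.2 < |q.1| then 1 else 0 : ℝ≥0∞)) := by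
    apply Measurable.ite _ measurable_const measurable_const
    apply measurableSet_lt <;> fun_prop
  calc _ ≤ ∫⁻ t, ∫⁻ x in Ioc (0:ℝ) 1, ENNReal.ofReal (|t| ^ (-1-s)) * (if x < |t| then 1 else 0) := by
        apply lintegral_mono
        intro t
        simp only []
        rw [lintegral_const_mul' _ _ (by simp)]
        gcongr
        exact h1 t
    _ = ∫⁻ x in Ioc (0:ℝ) 1, ∫⁻ t, ENNReal.ofReal (|t| ^ (-1-s)) * (if x < |t| then 1 else 0) := by
        rw [lintegral_lintegral_swap]
        apply Measurable.aemeasurable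
        apply Measurable.mul _ hmi
        fun_prop
    _ = ∫⁻ x in Ioc (0:ℝ) 1, ENNReal.ofReal (2 / s) * ENNReal.ofReal (x ^ (-s)) := by
        apply setLIntegral_congr_fun measurableSet_Ioc
        intro x hx
        simp only []
        rw [tail_int hs hx.1, ENNReal.ofReal_mul (by positivity)]
    _ = _ := by rw [lintegral_const_mul _ (by fun_prop)]

lemma upper_test {n : ℕ} (hN : 0 < n + 1) {s : ℝ} (hs : s ∈ Ioo (0:ℝ) 1) {f : ℝ → ℝ} {g : EE n → ℝ}
    {ε : ℝ} (hε : 0 < ε)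
    (hf : ContDiff ℝ (⊤ : ℕ∞) f) (hfs : ∀ x, x ∉ Icc ε (1 + ε) → f x = 0)
    (hf1 : ∀ x ∈ Icc (2*ε) 1, f x = 1) (hF : ∫⁻ x, ‖f x‖ₑ ≤ 1)
    (hA : ∀ t, ∫⁻ x, ‖f (x + t) - f x‖ₑ ≤ 2 * ENNReal.ofReal (min 1 |t|))
    (hg : ContDiff ℝ (⊤ : ℕ∞) g) (hgc : HasCompactSupport g) (hG : ∫⁻ z, ‖g z‖ₑ ≠ ∞)
    {K : ℝ≥0∞} (hB : ∀ h, ∫⁻ z, ‖g (z + h) - g z‖ₑ ≤ K * ENNReal.ofReal (min 1 ‖h‖))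
    {R : ℝ} (hR : 0 < R) :
    hardyConst (n+1) s 1 (halfSpace (n+1) hN) *
      ((∫⁻ x in Ioc (2*ε) 1, ENNReal.ofReal (x ^ (-s))) * ∫⁻ z, ‖g z‖ₑ) ≤
    Ce n s * ENNReal.ofReal (4 / s) * (∫⁻ x in Ioc (0:ℝ) 1, ENNReal.ofReal (x ^ (-s))) * (∫⁻ z, ‖g z‖ₑ)
      + K * ∫⁻ h : EE (n+1), kk n s h * ENNReal.ofReal (min 1 (‖h‖ / R)) := by
  have hfc := hf.continuous
  have hgcont := hg.continuous
  have hgm1 : ∀ w, Measurable (fun z => ‖g (R⁻¹ • (z + w))‖ₑ) := fun w =>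
    (by fun_prop : Continuous (fun z => g (R⁻¹ • (z + w)))).measurable.enorm
  have hgm2 : Measurable (fun z => ‖g (R⁻¹ • z)‖ₑ) :=
    (by fun_prop : Continuous (fun z => g (R⁻¹ • z))).measurable.enorm
  have hgm3 : ∀ w, Measurable (fun z => ‖g (R⁻¹ • (z + w)) - g (R⁻¹ • z)‖ₑ) := fun w =>
    (by fun_prop : Continuous (fun z => g (R⁻¹ • (z + w)) - g (R⁻¹ • z))).measurable.enorm
  set G := ∫⁻ z, ‖g z‖ₑ with hGdef
  set ρ := ENNReal.ofReal (|((R⁻¹) ^ n)⁻¹|) with hρ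
  have hρ0 : ρ ≠ 0 := by
    rw [hρ, Ne, ENNReal.ofReal_eq_zero, not_le]; positivity
  have hρt : ρ ≠ ∞ := by simp [hρ]
  have hRi : R⁻¹ ≠ 0 := by positivity
  have hGR : ∫⁻ z, ‖g (R⁻¹ • z)‖ₑ = ρ * G := lint_scale (F := fun z => ‖g z‖ₑ) (by fun_prop) hRi
  have hBR : ∀ h, ∫⁻ z, ‖g (R⁻¹ • (z + h)) - g (R⁻¹ • z)‖ₑ ≤ ρ * (K * ENNReal.ofReal (min 1 (‖h‖/R))) := by
    intro h
    have := lint_scale (F := fun z => ‖g (z + R⁻¹ • h) - g z‖ₑ) (by fun_prop) hRi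
    simp_rw [smul_add]
    rw [this]
    gcongr
    refine (hB _).trans (le_of_eq ?_)
    rw [norm_smul, norm_inv, Real.norm_of_nonneg hR.le, inv_mul_eq_div]
  set u : EE (n+1) → ℝ := fun x => f (x 0) * g (R⁻¹ • tl x) with hu
  have hus : ContDiff ℝ (⊤ : ℕ∞) u := by
    apply (hf.comp (by fun_prop)).mul
    apply hg.comp
    exact contDiff_tl.const_smul _
  have huc := hus.continuous
  have htl := continuous_tl (n := n)
  -- support
  have hsub : Function.support u ⊆ {x : EE (n+1) | ε ≤ x 0} := by
    intro x hx
    by_contra hn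
    apply hx
    simp only [hu]
    rw [hfs _ (fun h => hn h.1), zero_mul]
  have hclosed : IsClosed {x : EE (n+1) | ε ≤ x 0} := isClosed_le continuous_const (by fun_prop)
  have hts : tsupport u ⊆ halfSpace (n+1) hN := by
    intro x hx
    have h1 : ε ≤ x 0 := closure_minimal hsub hclosed hx
    exact lt_of_lt_of_le hε h1
  have hcomp : HasCompactSupport u := by
    obtain ⟨r, hr⟩ := hgc.isCompact.isBounded.subset_closedBall 0
    apply HasCompactSupport.of_support_subset_isCompact
      (isCompact_closedBall (0 : EE (n+1)) (1 + ε + R * |r|))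
    intro x hx
    have hfx : f (x 0) ≠ 0 := left_ne_zero_of_mul hx
    have hgx : g (R⁻¹ • tl x) ≠ 0 := right_ne_zero_of_mul hx
    have h1 : x 0 ∈ Icc ε (1 + ε) := by
      by_contra hn; exact hfx (hfs _ hn)
    have h2 := hr (subset_tsupport _ hgx)
    rw [mem_closedBall_zero_iff, norm_smul, norm_inv, Real.norm_of_nonneg hR.le, inv_mul_le_iff₀ hR] at h2
    rw [mem_closedBall_zero_iff]
    have h3 : R * r ≤ R * |r| := by gcongr; exact le_abs_self r
    have h4 : 0 ≤ R * |r| := by positivity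
    apply abs_le_of_sq_le_sq' _ (by linarith [h1.1]) |>.2
    rw [norm_split]
    have h5 := norm_nonneg (tl x)
    nlinarith [h1.1, h1.2]
  -- JJ
  have hJJ : JJ s u = (∫⁻ t in Ioi (0:ℝ), ‖f t‖ₑ * ENNReal.ofReal (t ^ (-s))) * (ρ * G) := by
    unfold JJ
    have hms : MeasurableSet {x : EE (n+1) | 0 < x 0} := measurableSet_lt measurable_const (meas_coord 0)
    rw [← lintegral_indicator hms, ← lintegral_indicator measurableSet_Ioi]
    have hmt : Measurable (fun t => (Ioi (0:ℝ)).indicator (fun t => ‖f t‖ₑ * ENNReal.ofReal (t ^ (-s))) t) := by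
      apply Measurable.indicator (by fun_prop) measurableSet_Ioi
    have h1 := lint_split (n := n) (F := fun q => (Ioi (0:ℝ)).indicator (fun t => ‖f t‖ₑ * ENNReal.ofReal (t ^ (-s))) q.1 * ‖g (R⁻¹ • q.2)‖ₑ)
      ((hmt.comp measurable_fst).mul (hgm2.comp measurable_snd))
    rw [← hGR, ← lintegral_mul_const _ hmt]
    calc _ = _ := by
          congr 1; ext x
          simp only [indicator, mem_ofPred_eq, mem_Ioi, hu]
          split_ifs
          · rw [enorm_mul]; ring
          · simp
      _ = _ := h1
      _ = _ := by
          congr 1; ext t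
          simp only []
          rw [lintegral_const_mul _ hgm2]
  have hJt : JJ s u ≠ ∞ := by
    rw [hJJ]
    apply ENNReal.mul_ne_top _ (ENNReal.mul_ne_top hρt hG)
    apply ne_top_of_le_ne_top (b := ENNReal.ofReal (ε ^ (-s)) * 1) (by simp)
    calc _ ≤ ∫⁻ t in Ioi (0:ℝ), ENNReal.ofReal (ε ^ (-s)) * ‖f t‖ₑ := by
          apply lintegral_mono
          intro t
          simp only []
          by_cases ht : t ∈ Icc ε (1+ε)
          · rw [mul_comm]
            have := Real.rpow_le_rpow_of_nonpos hε ht.1 (by linarith [hs.1] : -s ≤ 0)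
            gcongr
          · simp [hfs t ht]
      _ ≤ ∫⁻ t, ENNReal.ofReal (ε ^ (-s)) * ‖f t‖ₑ := setLIntegral_le_lintegral _ _
      _ ≤ _ := by
          rw [lintegral_const_mul _ (by fun_prop)]; gcongr
  have hJl : (∫⁻ x in Ioc (2*ε) 1, ENNReal.ofReal (x ^ (-s))) ≤ ∫⁻ t in Ioi (0:ℝ), ‖f t‖ₑ * ENNReal.ofReal (t ^ (-s)) := by
    calc _ = ∫⁻ t in Ioc (2*ε) 1, ‖f t‖ₑ * ENNReal.ofReal (t ^ (-s)) := by
          apply setLIntegral_congr_fun measurableSet_Ioc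
          intro t ht
          simp only []
          rw [hf1 t ⟨ht.1.le, ht.2⟩]; simp
      _ ≤ _ := by
          apply lintegral_mono_set
          intro t ht
          exact lt_trans (by linarith) ht.1
  -- DD
  have hD : ∀ h, DD u h ≤ ρ * (2 * G * ENNReal.ofReal (min 1 |h 0|) + K * ENNReal.ofReal (min 1 (‖h‖/R))) := by
    intro h
    calc DD u h = ∫⁻ t, ∫⁻ z, ‖f (t + h 0) * g (R⁻¹ • (z + tl h)) - f t * g (R⁻¹ • z)‖ₑ := by
          rw [DD, ← lint_split (F := fun q : ℝ × EE n => ‖f (q.1 + h 0) * g (R⁻¹ • (q.2 + tl h)) - f q.1 * g (R⁻¹ • q.2)‖ₑ) (by fun_prop)]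
          rfl
      _ ≤ ∫⁻ t, ∫⁻ z, (‖f (t + h 0) - f t‖ₑ * ‖g (R⁻¹ • (z + tl h))‖ₑ + ‖f t‖ₑ * ‖g (R⁻¹ • (z + tl h)) - g (R⁻¹ • z)‖ₑ) := by
          gcongr with t z
          rw [← enorm_mul, ← enorm_mul]
          refine le_trans (le_of_eq ?_) (enorm_add_le _ _)
          congr 1; ring
      _ = ∫⁻ t, (‖f (t + h 0) - f t‖ₑ * (ρ * G) + ‖f t‖ₑ * ∫⁻ z, ‖g (R⁻¹ • (z + tl h)) - g (R⁻¹ • z)‖ₑ) := by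
          congr 1; ext t
          rw [lintegral_add_left ((hgm1 _).const_mul _), lintegral_const_mul _ (hgm1 _), lintegral_const_mul _ (hgm3 _),
            lintegral_add_right_eq_self (fun z => ‖g (R⁻¹ • z)‖ₑ), hGR]
      _ = (∫⁻ t, ‖f (t + h 0) - f t‖ₑ) * (ρ * G) + (∫⁻ t, ‖f t‖ₑ) * ∫⁻ z, ‖g (R⁻¹ • (z + tl h)) - g (R⁻¹ • z)‖ₑ := by
          rw [lintegral_add_left (by fun_prop), lintegral_mul_const _ (by fun_prop), lintegral_mul_const _ (by fun_prop)]
      _ ≤ 2 * ENNReal.ofReal (min 1 |h 0|) * (ρ * G) + 1 * (ρ * (K * ENNReal.ofReal (min 1 (‖h‖/R)))) := by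
          gcongr
          · exact hA _
          · refine (hBR _).trans ?_
            gcongr
            exact norm_tl_le h
      _ = _ := by ring
  have hkm := meas_kk n s
  have hgag : gagliardo (n+1) s 1 univ u ≤ ρ * (Ce n s * ENNReal.ofReal (4 / s) * (∫⁻ x in Ioc (0:ℝ) 1, ENNReal.ofReal (x ^ (-s))) * G
      + K * ∫⁻ h : EE (n+1), kk n s h * ENNReal.ofReal (min 1 (‖h‖ / R))) := by
    rw [gag_eq huc]
    calc _ ≤ ∫⁻ h : EE (n+1), ρ * (2 * G * (kk n s h * ENNReal.ofReal (min 1 |h 0|)) + K * (kk n s h * ENNReal.ofReal (min 1 (‖h‖/R)))) := by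
          apply lintegral_mono
          intro h
          simp only []
          refine (mul_le_mul_right (hD h) _).trans (le_of_eq ?_)
          ring
      _ = ρ * (2 * G * (∫⁻ h : EE (n+1), kk n s h * ENNReal.ofReal (min 1 |h 0|)) + K * ∫⁻ h : EE (n+1), kk n s h * ENNReal.ofReal (min 1 (‖h‖ / R))) := by
          rw [lintegral_const_mul _ (by fun_prop), lintegral_add_left (by fun_prop), lintegral_const_mul _ (by fun_prop), lintegral_const_mul _ (by fun_prop)]
      _ ≤ _ := by
          refine mul_le_mul_right (add_le_add_left ?_ _) _
          rw [kk_slice hs.1 (φ := fun t => ENNReal.ofReal (min 1 |t|)) (by fun_prop)]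
          have h4 : ENNReal.ofReal (4 / s) = 2 * ENNReal.ofReal (2 / s) := by
            rw [show (2 : ℝ≥0∞) = ENNReal.ofReal 2 by simp, ← ENNReal.ofReal_mul (by norm_num)]
            congr 1; ring
          calc _ ≤ 2 * G * (Ce n s * (ENNReal.ofReal (2 / s) * ∫⁻ x in Ioc (0:ℝ) 1, ENNReal.ofReal (x ^ (-s)))) := by
                gcongr
                exact min_int hs.1
            _ = _ := by rw [h4]; ring
  have hfin := (hardy_le hN hus hcomp hts hJt).trans hgag
  have h6 : ρ * (hardyConst (n+1) s 1 (halfSpace (n+1) hN) *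
      ((∫⁻ x in Ioc (2*ε) 1, ENNReal.ofReal (x ^ (-s))) * G)) ≤ hardyConst (n+1) s 1 (halfSpace (n+1) hN) * JJ s u := by
    rw [hJJ]
    calc _ = hardyConst (n+1) s 1 (halfSpace (n+1) hN) *
      ((∫⁻ x in Ioc (2*ε) 1, ENNReal.ofReal (x ^ (-s))) * (ρ * G)) := by ring
      _ ≤ _ := by gcongr
  exact (ENNReal.mul_le_mul_iff_right hρ0 hρt).1 (h6.trans hfin)

lemma upper_main {n : ℕ} (hN : 0 < n + 1) {s : ℝ} (hs : s ∈ Ioo (0:ℝ) 1) :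
    hardyConst (n+1) s 1 (halfSpace (n+1) hN) ≤ ENNReal.ofReal (4 / s * Cconst (n+1) s) := by
  set Φ := hardyConst (n+1) s 1 (halfSpace (n+1) hN) with hΦ
  obtain ⟨g, hg, hgc, hG0, hGt, K, hK, hB⟩ := exists_g n
  set I0 := ∫⁻ x in Ioc (0:ℝ) 1, ENNReal.ofReal (x ^ (-s)) with hI0
  have step1 : ∀ ε : ℝ, 0 < ε → ε < 1/2 →
      Φ * (∫⁻ x in Ioc (2*ε) 1, ENNReal.ofReal (x ^ (-s))) ≤ Ce n s * ENNReal.ofReal (4 / s) * I0 := by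
    intro ε h1 h2
    obtain ⟨f, hf, hfs, -, hf1, hF, hA⟩ := exists_f h1 h2
    have h3 := fun m : ℕ => upper_test hN hs h1 hf hfs hf1 hF hA hg hgc hGt hB (R := (m : ℝ) + 1) (by positivity)
    have h4 := ENNReal.Tendsto.const_mul (a := K) (tend_kk (n := n) hs) (Or.inr hK)
    have h5 := (tendsto_const_nhds (x := Ce n s * ENNReal.ofReal (4 / s) * I0 * (∫⁻ z, ‖g z‖ₑ))).add h4
    rw [mul_zero, add_zero] at h5
    have h6 := ge_of_tendsto' h5 h3
    rw [← mul_assoc] at h6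
    exact (ENNReal.mul_le_mul_iff_left hG0 hGt).1 h6
  have step2 : Φ * I0 ≤ Ce n s * ENNReal.ofReal (4 / s) * I0 := by
    have hun : Ioc (0:ℝ) 1 = ⋃ m : ℕ, Ioc (2 * (1 / ((m:ℝ) + 3))) 1 := by
      ext x
      simp only [mem_Ioc, mem_iUnion]
      constructor
      · rintro ⟨h1, h2⟩
        obtain ⟨m, hm⟩ := exists_nat_gt (2 / x)
        refine ⟨m, ?_, h2⟩
        rw [div_lt_iff₀ h1] at hm
        rw [mul_one_div, div_lt_iff₀ (by positivity)]
        nlinarith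
      · rintro ⟨m, h1, h2⟩
        exact ⟨lt_trans (by positivity) h1, h2⟩
    have hdir : Monotone (fun m : ℕ => Ioc (2 * (1 / ((m:ℝ) + 3))) 1) := by
      intro m k hmk
      apply Ioc_subset_Ioc_left
      gcongr
    have : I0 = ⨆ m : ℕ, ∫⁻ x in Ioc (2 * (1 / ((m:ℝ) + 3))) 1, ENNReal.ofReal (x ^ (-s)) := by
      rw [hI0, hun, setLIntegral_iUnion_of_directed _ hdir.directed_le]
    nth_rewrite 1 [this]
    rw [ENNReal.mul_iSup]
    apply iSup_le
    intro m
    apply step1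
    · positivity
    · rw [div_lt_div_iff₀ (by positivity) (by norm_num)]
      have : (0:ℝ) ≤ m := by positivity
      linarith
  have hI0' : I0 = ENNReal.ofReal (1 / (1 - s)) := by
    have h1 : (0:ℝ) ≤ 1 := zero_le_one
    have hi := (intervalIntegral.intervalIntegrable_rpow' (a := 0) (b := 1) (r := -s) (by linarith [hs.2]))
    rw [intervalIntegrable_iff_integrableOn_Ioc_of_le zero_le_one] at hi
    rw [hI0, ← ofReal_integral_eq_lintegral_ofReal hi, ← intervalIntegral.integral_of_le h1, integral_rpow (Or.inl (by linarith [hs.2]))]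
    · congr 1
      have : -s + 1 ≠ 0 := by linarith [hs.2]
      rw [Real.one_rpow, Real.zero_rpow this]
      congr 1 <;> ring
    · filter_upwards [ae_restrict_mem measurableSet_Ioc] with x hx
      exact Real.rpow_nonneg hx.1.le _
  have hI0z : I0 ≠ 0 := by
    rw [hI0', Ne, ENNReal.ofReal_eq_zero, not_le]
    have : 0 < 1 - s := by linarith [hs.2]
    positivity
  have hI0t : I0 ≠ ∞ := by rw [hI0']; simp
  have h := (ENNReal.mul_le_mul_iff_left hI0z hI0t).1 step2
  have h4 : 0 < 4 / s := by have := hs.1; positivity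
  rwa [ENNReal.ofReal_mul h4.le, mul_comm, ← Ce_eq hs.1]

/-- `𝔥_{s,1}(ℍ^N₊) = (4/s) · C_{N,s}` for all `N ≥ 1` and `s ∈ (0,1)`. -/
theorem hardy_halfSpace_eq (N : ℕ) (hN : 0 < N) (s : ℝ) (hs : s ∈ Set.Ioo (0 : ℝ) 1) :
    hardyConst N s 1 (halfSpace N hN) = ENNReal.ofReal (4 / s * Cconst N s) := by
  obtain ⟨n, rfl⟩ : ∃ n, N = n + 1 := ⟨N - 1, by omega⟩
  exact le_antisymm (upper_main hN hs) (lower_main hN hs)
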